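/- Let (X,d) be a finite metric space and m ∈ ℕ. If c_1^{m,dom}(X,d) < ∞ (equivalently, if X admits a biLipschitz embedding into ℓ1^m), then the metric space (La(X), TSCP + ρ) admits a C-biLipschitz embedding into an ℓ1-product of 3m ℝ-trees, where C ≤ 6·c_1^{m,dom}(X,d) ≤ 6m·c_{ℓ1^m}(X,d). -/

import Mathlib

open Metric Set
open scoped Classical ENNReal NNReal

noncomputable section

/-- The underlying set of the lamplighter space over `X`: a lamp configuration
(a finite set of lit lamps) together with the position of the lamplighter. -/
abbrev Lamp (X : Type*) := Finset X × X

namespace Lamplighter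

variable {X Y Z : Type*}

/-- The length of the path visiting the points of a list in order,
with respect to the distance function `d`. -/
def pathLength (d : X → X → ℝ) : List X → ℝ
  | [] => 0
  | [_] => 0
  | x :: y :: l => d x y + pathLength d (y :: l)

/-- The symmetric difference of the lamp configurations of `p` and `q`, as a set. -/
def sd (p q : Lamp X) : Set X :=
  ((p.1 : Set X) \ (q.1 : Set X)) ∪ ((q.1 : Set X) \ (p.1 : Set X))

/-- The traveling salesman semimetric on the lamplighter space:
the infimum of lengths of finite paths starting at `p.2`, ending at `q.2`, and
visiting every point of the symmetric difference of the configurations. -/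
def TSP (d : X → X → ℝ) (p q : Lamp X) : ℝ :=
  sInf { s : ℝ | ∃ l : List X, l.head? = some p.2 ∧ l.getLast? = some q.2 ∧
    (∀ a ∈ sd p q, a ∈ l) ∧ s = pathLength d l }

/-- The diameter (in `ℝ≥0∞`) of a set with respect to a distance function `d`. -/
def ediamD (d : X → X → ℝ) (A : Set X) : ℝ≥0∞ :=
  ⨆ x ∈ A, ⨆ y ∈ A, ENNReal.ofReal (d x y)

/-- The traveling salesman shortcut semimetric:
`TSCP((A,x),(B,y)) = diam({x,y} ∪ (A Δ B))`. -/
def TSCP (d : X → X → ℝ) (p q : Lamp X) : ℝ :=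
  (ediamD d ({p.2, q.2} ∪ sd p q)).toReal

/-- `ρ((A,x),(B,y))` is `0` if `A = B` and `1` otherwise. -/
def rho (p q : Lamp X) : ℝ := if p.1 = q.1 then 0 else 1

/-- The lamplighter metric `d_La = TSP + ρ`. -/
def dLa (d : X → X → ℝ) (p q : Lamp X) : ℝ := TSP d p q + rho p q

/-- `X` is `K`-TSP-efficient if `TSP ≤ K • TSCP` on `La(X)²`. -/
def TSPEfficient (d : X → X → ℝ) (K : ℝ) : Prop :=
  ∀ p q : Lamp X, TSP d p q ≤ K * TSCP d p q

/-- A weak `C`-biLipschitz embedding between spaces with distance functions `dY`, `dZ`: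
a family of maps `φ t : Y → Z` (for `t > 0`) such that each `φ t` is `σ t`-Lipschitz
and `dY x y ≥ C*t` implies `dZ (φ t x) (φ t y) ≥ t * σ t`. -/
def WeakBiLip (dY : Y → Y → ℝ) (dZ : Z → Z → ℝ) (C : ℝ) : Prop :=
  ∃ φ : ℝ → Y → Z, ∀ t : ℝ, 0 < t → ∃ σ : ℝ, 0 < σ ∧
    (∀ x y : Y, dZ (φ t x) (φ t y) ≤ σ * dY x y) ∧
    (∀ x y : Y, C * t ≤ dY x y → t * σ ≤ dZ (φ t x) (φ t y))

/-- `f` is a `C`-biLipschitz embedding (an injective map of biLipschitz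
distortion at most `C`, allowing an overall scaling factor `s`). -/
def BiLipWith (dY : Y → Y → ℝ) (dZ : Z → Z → ℝ) (C : ℝ) (f : Y → Z) : Prop :=
  Function.Injective f ∧ ∃ s : ℝ, 0 < s ∧
    ∀ x y : Y, s * dY x y ≤ dZ (f x) (f y) ∧ dZ (f x) (f y) ≤ C * s * dY x y

/-- Nagata dimension at most `n` with constant at most `γ`: for every scale `s > 0`
there is a covering by sets of diameter at most `γ s` such that every set of diameter
less than `s` meets at most `n + 1` members of the covering. -/
def NagataDimD (d : Y → Y → ℝ) (n : ℕ) (γ : ℝ) : Prop :=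
  ∀ s : ℝ, 0 < s → ∃ B : Set (Set Y),
    (∀ y : Y, ∃ b ∈ B, y ∈ b) ∧
    (∀ b ∈ B, ediamD d b ≤ ENNReal.ofReal (γ * s)) ∧
    (∀ A : Set Y, ediamD d A < ENNReal.ofReal s →
      {b | b ∈ B ∧ (b ∩ A).Nonempty}.encard ≤ ((n : ℕ∞) + 1))

/-- Markov type 2 with constant `M`, for the distance function `d`: for every stationary
reversible Markov chain on a finite state space (given by a stationary distribution `μ`
and a reversible stochastic transition matrix `P`), every map `f` into the space, and
every time `t`, `E[d(f(Z_t),f(Z_0))²] ≤ M² t E[d(f(Z_1),f(Z_0))²]`. -/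
def HasMarkovType2 (d : Y → Y → ℝ) (M : ℝ) : Prop :=
  ∀ (n : ℕ) (μ : Fin n → ℝ) (P : Matrix (Fin n) (Fin n) ℝ),
    (∀ i, 0 ≤ μ i) → (∑ i, μ i) = 1 →
    (∀ i j, 0 ≤ P i j) → (∀ i, (∑ j, P i j) = 1) →
    (∀ i j, μ i * P i j = μ j * P j i) →
    ∀ (f : Fin n → Y) (t : ℕ),
      (∑ i, ∑ j, μ i * (P ^ t) i j * d (f i) (f j) ^ 2) ≤
        M ^ 2 * t * ∑ i, ∑ j, μ i * P i j * d (f i) (f j) ^ 2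

/-- `D`-doubling: every ball of radius `r` can be covered by `D` balls of radius `r/2`. -/
def Doubling (d : Y → Y → ℝ) (D : ℕ) : Prop :=
  ∀ r : ℝ, 0 < r → ∀ x : Y, ∃ c : Fin D → Y,
    ∀ y : Y, d x y ≤ r → ∃ i, d (c i) y ≤ r / 2

/-- `A` is an arc from `x` to `y`: the image of an injective continuous map of `[0,1]`
sending the endpoints to `x` and `y`. -/
def IsArc {T : Type*} [MetricSpace T] (x y : T) (A : Set T) : Prop :=
  ∃ γ : ℝ → T, ContinuousOn γ (Icc 0 1) ∧ InjOn γ (Icc 0 1) ∧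
    γ 0 = x ∧ γ 1 = y ∧ γ '' (Icc 0 1) = A

/-- `A` is a geodesic segment from `x` to `y`: the image of an isometric embedding
of `[0, dist x y]` sending the endpoints to `x` and `y`. -/
def IsGeodesicSeg {T : Type*} [MetricSpace T] (x y : T) (A : Set T) : Prop :=
  ∃ γ : ℝ → T, γ 0 = x ∧ γ (dist x y) = y ∧
    (∀ s ∈ Icc (0 : ℝ) (dist x y), ∀ t ∈ Icc (0 : ℝ) (dist x y),
      dist (γ s) (γ t) = |s - t|) ∧
    γ '' (Icc 0 (dist x y)) = A

/-- `T` is an ℝ-tree: any two (distinct) points are joined by a unique arc,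
and this arc is a geodesic. -/
def IsRTree (T : Type*) [MetricSpace T] : Prop :=
  ∀ x y : T, x ≠ y →
    (∃ A : Set T, IsArc x y A) ∧
    (∀ A A' : Set T, IsArc x y A → IsArc x y A' → A = A') ∧
    (∀ A : Set T, IsArc x y A → IsGeodesicSeg x y A)

/-- The sup (ℓ∞-product) distance on a finite product of metric spaces. -/
def piSupDist {n : ℕ} {T : Fin n → Type*} (I : ∀ i, MetricSpace (T i)) :
    (∀ i, T i) → (∀ i, T i) → ℝ :=
  letI := I
  fun f g => dist f g

/-- The ℓ1-product distance on a finite product of metric spaces. -/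
def piL1Dist {n : ℕ} {T : Fin n → Type*} (I : ∀ i, MetricSpace (T i)) :
    (∀ i, T i) → (∀ i, T i) → ℝ :=
  letI := I
  fun f g => ∑ i, dist (f i) (g i)

/-- The ℓ1 distance on `ℝ^m`. -/
def l1Dist (m : ℕ) (x y : Fin m → ℝ) : ℝ := ∑ i, |x i - y i|

/-- The ℓp distance on `ℝ^m`. -/
def lpDist (m : ℕ) (p : ℝ) (x y : Fin m → ℝ) : ℝ :=
  (∑ i, |x i - y i| ^ p) ^ (1 / p)

/-- The (pseudo)distance of the ℝ-star over the index type `ι`: the wedge sum of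
copies of `[0,∞)` indexed by `ι`, glued at `0`. -/
def starDist {ι : Type*} (p q : ι × ℝ≥0) : ℝ :=
  if p.1 = q.1 then |(p.2 : ℝ) - (q.2 : ℝ)| else (p.2 : ℝ) + (q.2 : ℝ)

/-- The sup (ℓ∞-product) of finitely many distance functions. -/
def supD {n : ℕ} {T : Fin n → Type*} (d : ∀ i, T i → T i → ℝ) (f g : ∀ i, T i) : ℝ :=
  ((Finset.univ.sup fun i => (d i (f i) (g i)).toNNReal : ℝ≥0) : ℝ)

/-- The infimum of distortions of biLipschitz embeddings of `(Y, dY)` into `(Z, dZ)`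
(`∞` if there is no such embedding). -/
def cEmb (dY : Y → Y → ℝ) (dZ : Z → Z → ℝ) : ℝ≥0∞ :=
  sInf { D : ℝ≥0∞ | ∃ C : ℝ, 0 < C ∧ D = ENNReal.ofReal C ∧
    ∃ f : Y → Z, BiLipWith dY dZ C f }

/-- `c_1^{m,dom}(X,d)`: the infimum of all `D > 0` such that there exist injective
`1`-Lipschitz maps `φ i : X → ℝ` and weights `α i ≥ 0` summing to `1` with
`∑ i, α i * |φ i x - φ i y| ≥ d x y / D` for all `x y` (`∞` if there is none). -/
def c1dom (d : X → X → ℝ) (m : ℕ) : ℝ≥0∞ :=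
  sInf { D : ℝ≥0∞ | ∃ C : ℝ, 0 < C ∧ D = ENNReal.ofReal C ∧
    ∃ (φ : Fin m → X → ℝ) (α : Fin m → ℝ),
      (∀ i, Function.Injective (φ i)) ∧
      (∀ i, ∀ x y : X, |φ i x - φ i y| ≤ d x y) ∧
      (∀ i, 0 ≤ α i) ∧ (∑ i, α i) = 1 ∧
      ∀ x y : X, d x y / C ≤ ∑ i, α i * |φ i x - φ i y| }

/-- The Hamming distance on the Hamming cube `{0,1}^M`, as a real number. -/
def hamDist {M : ℕ} (x y : Fin M → Bool) : ℝ :=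
  ((Finset.univ.filter fun i => x i ≠ y i).card : ℝ)

/-- The star graph `St_{n,k}`: the one-point coalescence of `n` paths of length `k`,
realized inside `ℤ^n` as the multiples `α eᵢ` with `0 ≤ α ≤ k`. -/
def St (n k : ℕ) : Type :=
  {x : Fin n → ℤ // ∃ i : Fin n, (∀ j : Fin n, j ≠ i → x j = 0) ∧ 0 ≤ x i ∧ x i ≤ (k : ℤ)}

/-- The ℓ1 metric on the star graph `St_{n,k}`. -/
def stDist {n k : ℕ} (x y : St n k) : ℝ := ∑ j, |(x.1 j : ℝ) - (y.1 j : ℝ)|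

/-- The endpoint `k eᵢ` of the `i`-th branch of the star graph. -/
def St.endpoint {n k : ℕ} (i : Fin n) : St n k :=
  ⟨fun j => if j = i then (k : ℤ) else 0, i, fun j hj => if_neg hj, by simp, by simp⟩

/-- The cycle metric on `ℤ/nℤ`. -/
def cycDist {n : ℕ} (a b : ZMod n) : ℝ := ((min ((a - b).val) ((b - a).val) : ℕ) : ℝ)

/-- The rectangular grid `G_{k,n} = ([0,k] ∩ ℤ) × ([0,n] ∩ ℤ)`. -/
def Grid2 (k n : ℕ) : Type :=
  {p : ℤ × ℤ // 0 ≤ p.1 ∧ p.1 ≤ (k : ℤ) ∧ 0 ≤ p.2 ∧ p.2 ≤ (n : ℤ)}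

/-- The ℓ1 metric on the grid `G_{k,n}`. -/
def grid2Dist {k n : ℕ} (x y : Grid2 k n) : ℝ :=
  |(x.1.1 : ℝ) - (y.1.1 : ℝ)| + |(x.1.2 : ℝ) - (y.1.2 : ℝ)|

/-- The `m`-dimensional grid `G^m({n_i}) = ∏ i, ([0, n_i] ∩ ℤ)`. -/
def GridM (m : ℕ) (n : Fin m → ℕ) : Type :=
  {p : Fin m → ℤ // ∀ i, 0 ≤ p i ∧ p i ≤ (n i : ℤ)}

/-- The ℓ1 metric on the `m`-dimensional grid. -/
def gridMDist {m : ℕ} {n : Fin m → ℕ} (x y : GridM m n) : ℝ :=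
  ∑ i, |(x.1 i : ℝ) - (y.1 i : ℝ)|

/-- In a metric space satisfying the four-point condition, a point `p` between `x` and `y` cuts off
an open set of points lying on the side of `x`. -/
lemma isOpen_side_of_fourPoint {T : Type*} [MetricSpace T]
    (h4 : ∀ x y z w : T, dist x y + dist z w ≤
      max (dist x z + dist y w) (dist x w + dist y z))
    {x y p : T} (hp : dist x p + dist p y = dist x y) :
    IsOpen {z : T | z ≠ p ∧ dist x z - dist y z ≤ dist x p - dist p y} := by
  rw [isOpen_iff_mem_nhds]
  rintro z ⟨hzp, hz⟩
  rcases hz.lt_or_eq with hlt | heq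
  · have hcont : Continuous fun z : T => dist x z - dist y z := by fun_prop
    filter_upwards [isOpen_ne.mem_nhds hzp, (isOpen_lt hcont continuous_const).mem_nhds hlt]
      with w hw hw'
    exact ⟨hw, le_of_lt hw'⟩
  · filter_upwards [Metric.ball_mem_nhds z (dist_pos.2 hzp)] with w hw
    rw [Metric.mem_ball] at hw
    refine ⟨fun h => by rw [h, dist_comm] at hw; exact lt_irrefl _ hw, ?_⟩
    have hyz : dist z p + dist p y ≤ dist y z := by
      have h := h4 x y z p
      rw [dist_comm y p, dist_comm p y] at *
      rcases le_max_iff.1 h with h | h <;> linarith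
    have h := h4 x w y z
    have htri := dist_triangle x w y
    rw [dist_comm y w] at *
    rw [dist_comm w z] at *
    rcases le_max_iff.1 h with h | h <;> linarith

/-- In a metric space satisfying the four-point condition, every arc between two points is the
image of every geodesic between them. -/
lemma IsArc.eq_image_geodesic {T : Type*} [MetricSpace T]
    (h4 : ∀ x y z w : T, dist x y + dist z w ≤
      max (dist x z + dist y w) (dist x w + dist y z))
    {x y : T} {A : Set T} (hA : IsArc x y A) {γ : ℝ → T} (h0 : γ 0 = x) (h1 : γ (dist x y) = y)
    (hγ : ∀ s ∈ Icc (0 : ℝ) (dist x y), ∀ t ∈ Icc (0 : ℝ) (dist x y),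
      dist (γ s) (γ t) = |s - t|) :
    A = γ '' Icc 0 (dist x y) := by
  obtain ⟨c, hcont, hinj, hc0, hc1, rfl⟩ := hA
  have hd : (0 : ℝ) ≤ dist x y := dist_nonneg
  set f : Icc (0 : ℝ) 1 → T := (Icc (0 : ℝ) 1).domRestrict c
  have hfc : Continuous f := continuousOn_iff_continuous_domRestrict.1 hcont
  have hfi : Function.Injective f := hinj.injective
  have hrange : range f = c '' Icc 0 1 := range_domRestrict _ _
  have hf0 : f 0 = x := hc0
  have hf1 : f 1 = y := hc1
  have hsub : γ '' Icc 0 (dist x y) ⊆ range f := by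
    rintro _ ⟨s, hs, rfl⟩
    by_contra hnot
    have hxp : dist x (γ s) = s := by
      have h := hγ 0 ⟨le_rfl, hd⟩ s hs
      rwa [h0, zero_sub, abs_neg, abs_of_nonneg hs.1] at h
    have hpy : dist (γ s) y = dist x y - s := by
      have h := hγ s hs (dist x y) ⟨hd, le_rfl⟩
      rwa [h1, abs_sub_comm, abs_of_nonneg (sub_nonneg.2 hs.2)] at h
    have hopen := (isOpen_side_of_fourPoint h4
      (show dist x (γ s) + dist (γ s) y = dist x y by linarith)).preimage hfc
    have hEq : f ⁻¹' {z : T | z ≠ γ s ∧ dist x z - dist y z ≤ dist x (γ s) - dist (γ s) y} =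
        {t | dist x (f t) - dist y (f t) ≤ dist x (γ s) - dist (γ s) y} := by
      ext t
      exact and_iff_right fun h => hnot ⟨t, h⟩
    rw [hEq] at hopen
    have hclopen : IsClopen {t | dist x (f t) - dist y (f t) ≤ dist x (γ s) - dist (γ s) y} :=
      ⟨isClosed_le (by fun_prop) continuous_const, hopen⟩
    have huniv := hclopen.eq_univ ⟨0, by
      simp only [mem_ofPred_eq, hf0, dist_self, hxp, hpy, dist_comm y x]
      linarith [hs.1]⟩
    have hone : (1 : Icc (0 : ℝ) 1) ∈
        {t | dist x (f t) - dist y (f t) ≤ dist x (γ s) - dist (γ s) y} := huniv ▸ mem_univ _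
    simp only [mem_ofPred_eq, hf1, dist_self, hxp, hpy] at hone
    have hsd : s = dist x y := le_antisymm hs.2 (by linarith)
    exact hnot ⟨1, by rw [hf1, hsd, h1]⟩
  have hγc : ContinuousOn γ (Icc 0 (dist x y)) := by
    refine (LipschitzOnWith.of_dist_le_mul (K := 1) fun s hs t ht => ?_).continuousOn
    rw [hγ s hs t ht, NNReal.coe_one, one_mul, Real.dist_eq]
  have hpre : IsPreconnected (f ⁻¹' (γ '' Icc 0 (dist x y))) := by
    rw [← (hfc.isClosedEmbedding hfi).isInducing.isPreconnected_image,
      image_preimage_eq_of_subset hsub]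
    exact isPreconnected_Icc.image _ hγc
  rw [← hrange]
  refine Subset.antisymm ?_ hsub
  rintro _ ⟨t, rfl⟩
  exact hpre.Icc_subset (a := 0) (b := 1)
    (by rw [mem_preimage, hf0]; exact ⟨0, ⟨le_rfl, hd⟩, h0⟩)
    (by rw [mem_preimage, hf1]; exact ⟨dist x y, ⟨hd, le_rfl⟩, h1⟩) ⟨t.2.1, t.2.2⟩

/-- A geodesic metric space satisfying the four-point condition is an `ℝ`-tree. -/
lemma isRTree_of_fourPoint {T : Type*} [MetricSpace T]
    (h4 : ∀ x y z w : T, dist x y + dist z w ≤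
      max (dist x z + dist y w) (dist x w + dist y z))
    (hgeo : ∀ x y : T, ∃ γ : ℝ → T, γ 0 = x ∧ γ (dist x y) = y ∧
      ∀ s ∈ Icc (0 : ℝ) (dist x y), ∀ t ∈ Icc (0 : ℝ) (dist x y),
        dist (γ s) (γ t) = |s - t|) : IsRTree T := by
  intro x y hxy
  obtain ⟨γ, h0, h1, hγ⟩ := hgeo x y
  have hd : 0 < dist x y := dist_pos.2 hxy
  refine ⟨⟨_, fun t => γ (dist x y * t), ?_, ?_, by simpa using h0, by simpa using h1, rfl⟩,
    fun A A' hA hA' => (hA.eq_image_geodesic h4 h0 h1 hγ).trans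
      (hA'.eq_image_geodesic h4 h0 h1 hγ).symm,
    fun A hA => ⟨γ, h0, h1, hγ, (hA.eq_image_geodesic h4 h0 h1 hγ).symm⟩⟩
  · refine (LipschitzOnWith.of_dist_le_mul (K := (dist x y).toNNReal)
      fun s hs t ht => ?_).continuousOn
    rw [hγ _ ⟨by nlinarith [hs.1], by nlinarith [hs.2]⟩ _
      ⟨by nlinarith [ht.1], by nlinarith [ht.2]⟩, ← mul_sub, abs_mul, abs_of_pos hd,
      Real.coe_toNNReal _ hd.le, Real.dist_eq]
  · intro s hs t ht hst
    have h := hγ (dist x y * s) ⟨by nlinarith [hs.1], by nlinarith [hs.2]⟩ (dist x y * t)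
      ⟨by nlinarith [ht.1], by nlinarith [ht.2]⟩
    have hst' : γ (dist x y * s) = γ (dist x y * t) := hst
    rw [dist_eq_zero.2 hst'] at h
    exact mul_left_cancel₀ hd.ne' (sub_eq_zero.1 (abs_eq_zero.1 h.symm))

/-- The points of the tree of lamp configurations above a level: `⟨A, t⟩` remembers only the lamps
`a` of `A` with `t < ψ a`, once points at distance `0` are identified. -/
structure ConfPoint {X : Type u} (ψ : X → ℝ) : Type u where
  /-- The lamp configuration. -/
  conf : Finset X
  /-- The level. -/
  level : ℝ

namespace ConfPoint

variable {ψ : X → ℝ}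

/-- The lowest level above both points at which the two configurations become equal. -/
def meet (p q : ConfPoint ψ) : ℝ :=
  (symmDiff p.conf q.conf).fold max (max p.level q.level) ψ

lemma meet_le_iff {p q : ConfPoint ψ} {c : ℝ} :
    p.meet q ≤ c ↔ (p.level ≤ c ∧ q.level ≤ c) ∧ ∀ a ∈ symmDiff p.conf q.conf, ψ a ≤ c := by
  rw [meet, Finset.fold_max_le, max_le_iff]

lemma level_le_meet_left (p q : ConfPoint ψ) : p.level ≤ p.meet q := (meet_le_iff.1 le_rfl).1.1

lemma level_le_meet_right (p q : ConfPoint ψ) : q.level ≤ p.meet q := (meet_le_iff.1 le_rfl).1.2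

lemma le_meet {p q : ConfPoint ψ} {a : X} (ha : a ∈ symmDiff p.conf q.conf) :
    ψ a ≤ p.meet q := (meet_le_iff.1 le_rfl).2 a ha

lemma meet_comm (p q : ConfPoint ψ) : p.meet q = q.meet p := by
  rw [meet, meet, symmDiff_comm, max_comm]

lemma meet_of_conf_eq {p q : ConfPoint ψ} (h : p.conf = q.conf) :
    p.meet q = max p.level q.level := by
  simp [meet, h]

lemma meet_ultra (p q r : ConfPoint ψ) : p.meet r ≤ max (p.meet q) (q.meet r) := by
  refine meet_le_iff.2 ⟨⟨(level_le_meet_left p q).trans (le_max_left _ _),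
    (level_le_meet_right q r).trans (le_max_right _ _)⟩, fun a ha => ?_⟩
  rcases Finset.mem_union.1 (symmDiff_triangle p.conf q.conf r.conf ha) with h | h
  · exact (le_meet h).trans (le_max_left _ _)
  · exact (le_meet h).trans (le_max_right _ _)

instance : PseudoMetricSpace (ConfPoint ψ) where
  dist p q := 2 * p.meet q - p.level - q.level
  dist_self p := by rw [meet_of_conf_eq rfl, max_self]; ring
  dist_comm p q := by rw [meet_comm]; ring
  dist_triangle p q r := by
    have h1 := level_le_meet_right p q
    have h2 := level_le_meet_left q r
    rcases le_max_iff.1 (meet_ultra p q r) with h | h <;> linarith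

lemma dist_def (p q : ConfPoint ψ) : dist p q = 2 * p.meet q - p.level - q.level := rfl

lemma fourPoint (x y z w : ConfPoint ψ) :
    dist x y + dist z w ≤ max (dist x z + dist y w) (dist x w + dist y z) := by
  simp only [dist_def, le_max_iff]
  have h1 := le_max_iff.1 (meet_ultra x z y)
  have h2 := le_max_iff.1 (meet_ultra x w y)
  have h3 := le_max_iff.1 (meet_ultra z x w)
  have h4 := le_max_iff.1 (meet_ultra z y w)
  rw [meet_comm z y, meet_comm z x, meet_comm w y] at *
  by_contra! hcon
  obtain ⟨hc1, hc2⟩ := hcon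
  rcases h1 with h1 | h1 <;> rcases h2 with h2 | h2 <;> rcases h3 with h3 | h3 <;>
    rcases h4 with h4 | h4 <;> linarith

lemma dist_mk_mk (A : Finset X) (s t : ℝ) :
    dist (⟨A, s⟩ : ConfPoint ψ) ⟨A, t⟩ = |s - t| := by
  rw [dist_def, meet_of_conf_eq (p := ⟨A, s⟩) (q := ⟨A, t⟩) rfl]
  dsimp only
  rcases le_total s t with h | h
  · rw [max_eq_right h, abs_of_nonpos (by linarith)]; ring
  · rw [max_eq_left h, abs_of_nonneg (by linarith)]; ring

lemma meet_raise {p q : ConfPoint ψ} {s t : ℝ} (hs : p.level ≤ s) (hs' : s ≤ p.meet q)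
    (ht : q.level ≤ t) (ht' : t ≤ p.meet q) :
    (⟨p.conf, s⟩ : ConfPoint ψ).meet ⟨q.conf, t⟩ = p.meet q := by
  apply le_antisymm
  · exact meet_le_iff.2 ⟨⟨hs', ht'⟩, fun a ha => le_meet ha⟩
  · refine meet_le_iff.2 ⟨⟨hs.trans (level_le_meet_left ⟨p.conf, s⟩ ⟨q.conf, t⟩),
      ht.trans (level_le_meet_right ⟨p.conf, s⟩ ⟨q.conf, t⟩)⟩, fun a ha => ?_⟩
    exact le_meet (p := (⟨p.conf, s⟩ : ConfPoint ψ)) (q := ⟨q.conf, t⟩) ha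

/-- The path going up from `p` to the meeting level, and then down to `q`. -/
def path (p q : ConfPoint ψ) (s : ℝ) : ConfPoint ψ :=
  if p.level + s ≤ p.meet q then ⟨p.conf, p.level + s⟩
  else ⟨q.conf, 2 * p.meet q - p.level - s⟩

lemma dist_path (p q : ConfPoint ψ) {s t : ℝ} (hs : s ∈ Icc 0 (dist p q))
    (ht : t ∈ Icc 0 (dist p q)) : dist (path p q s) (path p q t) = |s - t| := by
  wlog hst : s ≤ t generalizing s t
  · rw [dist_comm, abs_sub_comm, this ht hs (le_of_not_ge hst)]
  rw [dist_def] at hs ht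
  obtain ⟨hs0, hs1⟩ := hs
  obtain ⟨ht0, ht1⟩ := ht
  unfold path
  split_ifs with h h' h'
  · rw [dist_mk_mk]
    congr 1
    ring
  · rw [dist_def, meet_raise (by linarith) h (by linarith) (by linarith),
      abs_of_nonpos (by linarith)]
    ring
  · linarith
  · rw [dist_mk_mk, abs_sub_comm]
    congr 1
    ring

lemma path_zero (p q : ConfPoint ψ) : path p q 0 = p := by
  rw [path, if_pos (by simpa using level_le_meet_left p q), add_zero]

lemma dist_path_dist (p q : ConfPoint ψ) : dist (path p q (dist p q)) q = 0 := by
  rw [dist_def p q, path]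
  split_ifs with h
  · have hq := level_le_meet_right p q
    rw [dist_def]
    change 2 * meet (⟨p.conf, _⟩ : ConfPoint ψ) ⟨q.conf, q.level⟩ - _ - _ = 0
    rw [meet_raise (by linarith [level_le_meet_left p q]) h le_rfl hq]
    change 2 * p.meet q - (p.level + (2 * p.meet q - p.level - q.level)) - q.level = 0
    ring
  · change dist (⟨q.conf, _⟩ : ConfPoint ψ) ⟨q.conf, q.level⟩ = 0
    rw [dist_mk_mk]
    change |2 * p.meet q - p.level - (2 * p.meet q - p.level - q.level) - q.level| = 0
    rw [abs_eq_zero]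
    ring

end ConfPoint

/-- The `ℝ`-tree of lamp configurations above a level. -/
abbrev ConfTree {X : Type u} (ψ : X → ℝ) : Type u := SeparationQuotient (ConfPoint ψ)

lemma ConfTree.isRTree (ψ : X → ℝ) : IsRTree (ConfTree ψ) := by
  refine isRTree_of_fourPoint (fun x y z w => ?_) fun x y => ?_
  · obtain ⟨x, rfl⟩ := SeparationQuotient.surjective_mk x
    obtain ⟨y, rfl⟩ := SeparationQuotient.surjective_mk y
    obtain ⟨z, rfl⟩ := SeparationQuotient.surjective_mk z
    obtain ⟨w, rfl⟩ := SeparationQuotient.surjective_mk w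
    simpa only [SeparationQuotient.dist_mk] using ConfPoint.fourPoint _ _ _ _
  · obtain ⟨p, rfl⟩ := SeparationQuotient.surjective_mk x
    obtain ⟨q, rfl⟩ := SeparationQuotient.surjective_mk y
    refine ⟨fun s => SeparationQuotient.mk (ConfPoint.path p q s), ?_, ?_, fun s hs t ht => ?_⟩
    · simp only [ConfPoint.path_zero]
    · rw [← dist_eq_zero, SeparationQuotient.dist_mk, SeparationQuotient.dist_mk,
        ConfPoint.dist_path_dist]
    · rw [SeparationQuotient.dist_mk] at hs ht ⊢
      exact ConfPoint.dist_path p q hs ht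

lemma mem_symmDiff_iff_mem_sd (p q : Lamp X) {a : X} : a ∈ symmDiff p.1 q.1 ↔ a ∈ sd p q := by
  simp [Finset.mem_symmDiff, sd]

lemma rho_nonneg (p q : Lamp X) : 0 ≤ rho p q := by
  unfold rho
  split_ifs <;> norm_num

/-- The highest value of `ψ` on the set defining `TSCP p q`. -/
def top (ψ : X → ℝ) (p q : Lamp X) : ℝ :=
  ConfPoint.meet (⟨p.1, ψ p.2⟩ : ConfPoint ψ) ⟨q.1, ψ q.2⟩

lemma top_le_iff {ψ : X → ℝ} {p q : Lamp X} {c : ℝ} :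
    top ψ p q ≤ c ↔ ∀ a ∈ ({p.2, q.2} ∪ sd p q : Set X), ψ a ≤ c := by
  rw [top, ConfPoint.meet_le_iff]
  simp only [mem_symmDiff_iff_mem_sd]
  constructor
  · rintro ⟨⟨h1, h2⟩, h3⟩ a ((rfl | rfl) | ha)
    exacts [h1, h2, h3 a ha]
  · exact fun h => ⟨⟨h _ (Or.inl (Or.inl rfl)), h _ (Or.inl (Or.inr rfl))⟩,
      fun a ha => h a (Or.inr ha)⟩

lemma abs_sub_le_top_add {ψ : X → ℝ} {p q : Lamp X} {a b : X}
    (ha : a ∈ ({p.2, q.2} ∪ sd p q : Set X)) (hb : b ∈ ({p.2, q.2} ∪ sd p q : Set X)) :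
    |ψ a - ψ b| ≤ top ψ p q + top (-ψ) p q := by
  have h := top_le_iff.1 (le_refl (top ψ p q))
  have h' := top_le_iff.1 (le_refl (top (-ψ) p q))
  have h1 := h a ha
  have h2 := h b hb
  have h3 := h' a ha
  have h4 := h' b hb
  simp only [Pi.neg_apply] at h3 h4
  exact abs_le.2 ⟨by linarith, by linarith⟩

section TSCP

variable [MetricSpace X]

lemma TSCP_le {p q : Lamp X} {c : ℝ} (hc : 0 ≤ c)
    (h : ∀ a ∈ ({p.2, q.2} ∪ sd p q : Set X), ∀ b ∈ ({p.2, q.2} ∪ sd p q : Set X),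
      dist a b ≤ c) : TSCP dist p q ≤ c := by
  refine ENNReal.toReal_le_of_le_ofReal hc ?_
  exact iSup₂_le fun a ha => iSup₂_le fun b hb => ENNReal.ofReal_le_ofReal (h a ha b hb)

lemma dist_le_TSCP [Finite X] {p q : Lamp X} {a b : X}
    (ha : a ∈ ({p.2, q.2} ∪ sd p q : Set X)) (hb : b ∈ ({p.2, q.2} ∪ sd p q : Set X)) :
    dist a b ≤ TSCP dist p q := by
  have hfin : ediamD dist ({p.2, q.2} ∪ sd p q : Set X) ≠ ⊤ := by
    refine ne_top_of_le_ne_top (ENNReal.ofReal_ne_top (r := Metric.diam (univ : Set X))) ?_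
    exact iSup₂_le fun a _ => iSup₂_le fun b _ => ENNReal.ofReal_le_ofReal
      (Metric.dist_le_diam_of_mem finite_univ.isBounded (mem_univ a) (mem_univ b))
  refine (ENNReal.ofReal_le_iff_le_toReal hfin).1 ?_
  exact (le_iSup₂ (f := fun b _ => ENNReal.ofReal (dist a b)) b hb).trans
    (le_iSup₂ (f := fun a _ => ⨆ b ∈ ({p.2, q.2} ∪ sd p q : Set X),
      ENNReal.ofReal (dist a b)) a ha)

lemma TSCP_nonneg (p q : Lamp X) : 0 ≤ TSCP dist p q := ENNReal.toReal_nonneg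

lemma top_add_le [Finite X] {ψ : X → ℝ} {k : ℝ} (hk : 0 ≤ k)
    (hψ : ∀ a b, |ψ a - ψ b| ≤ k * dist a b) (p q : Lamp X) :
    top ψ p q + top (-ψ) p q ≤ k * TSCP dist p q := by
  rw [← le_sub_iff_add_le]
  refine top_le_iff.2 fun a ha => ?_
  rw [le_sub_comm]
  refine top_le_iff.2 fun b hb => ?_
  have h1 := (le_abs_self _).trans (hψ a b)
  have h2 := mul_le_mul_of_nonneg_left (dist_le_TSCP ha hb) hk
  simp only [Pi.neg_apply]
  linarith

end TSCP

/-- The height functions defining the three trees associated with a function `ψ`. -/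
def treeHeight (ψ : X → ℝ) : Fin 3 → X → ℝ := ![ψ, -ψ, 0]

/-- The levels at which the lamplighter is placed in the three trees associated with `ψ`. -/
def treeLevel (c : ℝ) (ψ : X → ℝ) : Fin 3 → X → ℝ := ![ψ, -ψ, fun _ => -c]

/-- The map from the lamplighter space to one of the three trees associated with `ψ`. -/
def toTree (c : ℝ) (ψ : X → ℝ) (j : Fin 3) (p : Lamp X) : ConfTree (treeHeight ψ j) :=
  SeparationQuotient.mk ⟨p.1, treeLevel c ψ j p.2⟩

lemma dist_toTree_two {c : ℝ} (hc : 0 ≤ c) (ψ : X → ℝ) (p q : Lamp X) :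
    dist (toTree c ψ 2 p) (toTree c ψ 2 q) = 2 * c * rho p q := by
  rw [toTree, toTree, SeparationQuotient.dist_mk, ConfPoint.dist_def]
  change 2 * ConfPoint.meet (⟨p.1, -c⟩ : ConfPoint (0 : X → ℝ)) ⟨q.1, -c⟩ - -c - -c = _
  by_cases h : p.1 = q.1
  · rw [ConfPoint.meet_of_conf_eq h, rho, if_pos h, max_self]
    ring
  · have hm : ConfPoint.meet (⟨p.1, -c⟩ : ConfPoint (0 : X → ℝ)) ⟨q.1, -c⟩ = 0 := by
      apply le_antisymm
      · exact ConfPoint.meet_le_iff.2 ⟨⟨neg_nonpos.2 hc, neg_nonpos.2 hc⟩, fun a _ => le_rfl⟩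
      · obtain ⟨a, ha⟩ := Finset.symmDiff_nonempty.2 h
        exact ConfPoint.le_meet (ψ := (0 : X → ℝ)) (p := ⟨p.1, -c⟩) (q := ⟨q.1, -c⟩) ha
    rw [hm, rho, if_neg h]
    ring

lemma sum_dist_toTree {c : ℝ} (hc : 0 ≤ c) (ψ : X → ℝ) (p q : Lamp X) :
    ∑ j, dist (toTree c ψ j p) (toTree c ψ j q) =
      2 * (top ψ p q + top (-ψ) p q) + 2 * c * rho p q := by
  have h0 : dist (toTree c ψ 0 p) (toTree c ψ 0 q) = 2 * top ψ p q - ψ p.2 - ψ q.2 := rfl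
  have h1 : dist (toTree c ψ 1 p) (toTree c ψ 1 q) = 2 * top (-ψ) p q - -ψ p.2 - -ψ q.2 := rfl
  rw [Fin.sum_univ_three, h0, h1, dist_toTree_two hc]
  ring

/-- A family of `m` functions controlling the metric of `X` from both sides yields an embedding of
the lamplighter space into an `ℓ1`-product of `3 * m` trees. -/
lemma exists_biLipWith_trees {X : Type u} [MetricSpace X] [Finite X] {m : ℕ} (hm : 0 < m)
    (ψ : Fin m → X → ℝ) (k : Fin m → ℝ) {E C : ℝ} (hE : 0 < E) (hk : ∀ i, 0 ≤ k i)
    (hψ : ∀ i a b, |ψ i a - ψ i b| ≤ k i * dist a b)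
    (hψ' : ∀ a b, dist a b ≤ E * ∑ i, |ψ i a - ψ i b|)
    (hC : (∑ i, k i) * E ≤ C) (hC1 : 1 ≤ C) :
    ∃ (T : Fin (3 * m) → Type u) (I : ∀ i, MetricSpace (T i)),
      (∀ i, @IsRTree (T i) (I i)) ∧
      ∃ f : Lamp X → ∀ i, T i,
        BiLipWith (fun p q : Lamp X => TSCP (dist : X → X → ℝ) p q + rho p q)
          (piL1Dist I) C f := by
  have hm' : (0 : ℝ) < m := Nat.cast_pos.2 hm
  set c : ℝ := 1 / (m * E) with hc_def
  have hc : 0 < c := by positivity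
  have hcm : m * (2 * c) = 2 / E := by
    rw [hc_def]
    field_simp
  let e : Fin (3 * m) → Fin 3 × Fin m := finProdFinEquiv.symm
  let I : ∀ j, MetricSpace (ConfTree (treeHeight (ψ (e j).2) (e j).1)) := fun _ => inferInstance
  let f : Lamp X → ∀ j, ConfTree (treeHeight (ψ (e j).2) (e j).1) :=
    fun p j => toTree c (ψ (e j).2) (e j).1 p
  have hsum : ∀ p q, piL1Dist I (f p) (f q) =
      2 * ∑ i, (top (ψ i) p q + top (-ψ i) p q) + 2 / E * rho p q := by
    intro p q
    calc piL1Dist I (f p) (f q)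
        = ∑ j : Fin (3 * m), dist (toTree c (ψ (e j).2) (e j).1 p)
            (toTree c (ψ (e j).2) (e j).1 q) := rfl
      _ = ∑ z : Fin 3 × Fin m, dist (toTree c (ψ z.2) z.1 p) (toTree c (ψ z.2) z.1 q) :=
          Equiv.sum_comp finProdFinEquiv.symm
            fun z : Fin 3 × Fin m => dist (toTree c (ψ z.2) z.1 p) (toTree c (ψ z.2) z.1 q)
      _ = ∑ i, ∑ j, dist (toTree c (ψ i) j p) (toTree c (ψ i) j q) :=
          Fintype.sum_prod_type_right _
      _ = _ := by
          simp only [sum_dist_toTree hc.le, Finset.sum_add_distrib, ← Finset.mul_sum,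
            Finset.sum_const, Finset.card_univ, Fintype.card_fin, nsmul_eq_mul]
          rw [← hcm]
          ring
  have hlower : ∀ p q, 2 / E * (TSCP dist p q + rho p q) ≤ piL1Dist I (f p) (f q) := by
    intro p q
    have hle : ∀ a ∈ ({p.2, q.2} ∪ sd p q : Set X), ∀ b ∈ ({p.2, q.2} ∪ sd p q : Set X),
        dist a b ≤ E * ∑ i, (top (ψ i) p q + top (-ψ i) p q) := fun a ha b hb =>
      (hψ' a b).trans (mul_le_mul_of_nonneg_left
        (Finset.sum_le_sum fun i _ => abs_sub_le_top_add ha hb) hE.le)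
    have hp : p.2 ∈ ({p.2, q.2} ∪ sd p q : Set X) := Or.inl (Or.inl rfl)
    have h := mul_le_mul_of_nonneg_left (TSCP_le (dist_nonneg.trans (hle _ hp _ hp)) hle)
      (show 0 ≤ 2 / E by positivity)
    have hE' : ∀ x : ℝ, 2 / E * (E * x) = 2 * x := fun x => by field_simp
    rw [hE'] at h
    rw [hsum, mul_add]
    linarith
  refine ⟨_, I, fun j => ConfTree.isRTree _, f, fun p q hpq => ?_, 2 / E, by positivity,
    fun p q => ⟨hlower p q, ?_⟩⟩
  · have h := hlower p q
    have h0 : piL1Dist I (f p) (f q) = 0 := by simp [hpq, piL1Dist]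
    rw [h0] at h
    have h' : TSCP dist p q + rho p q ≤ 0 := nonpos_of_mul_nonpos_right h (by positivity)
    have hT := TSCP_nonneg p q
    have hρ := rho_nonneg p q
    have hd : dist p.2 q.2 ≤ TSCP dist p q :=
      dist_le_TSCP (Or.inl (Or.inl rfl)) (Or.inl (Or.inr rfl))
    refine Prod.ext ?_ (dist_le_zero.1 (by linarith))
    by_contra hne
    rw [rho, if_neg hne] at h'
    linarith
  · have hT := TSCP_nonneg p q
    have hρ := rho_nonneg p q
    have h1 : ∑ i, (top (ψ i) p q + top (-ψ i) p q) ≤ (∑ i, k i) * TSCP dist p q := by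
      rw [Finset.sum_mul]
      exact Finset.sum_le_sum fun i _ => top_add_le (hk i) (hψ i) p q
    have h2 : (∑ i, k i) * TSCP dist p q ≤ C / E * TSCP dist p q :=
      mul_le_mul_of_nonneg_right ((le_div_iff₀ hE).2 hC) hT
    have h3 : 2 / E * rho p q ≤ C * (2 / E) * rho p q :=
      mul_le_mul_of_nonneg_right (le_mul_of_one_le_left (by positivity) hC1) hρ
    have h4 : C * (2 / E) = 2 * (C / E) := by ring
    rw [hsum, mul_add]
    rw [h4] at h3 ⊢
    linarith

/-- Let `X` be a finite metric space with `c_1^{m,dom}(X,d) < ∞`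
(equivalently, `X` biLipschitz embeds into `ℓ1^m`). Then `(La(X), TSCP + ρ)` admits a
`C`-biLipschitz embedding into an ℓ1-product of `3m` ℝ-trees with
`C ≤ 6 · c_1^{m,dom}(X,d) ≤ 6m · c_{ℓ1^m}(X,d)` (expressed here by: for every
`D ≥ 1` strictly above the respective infimum, there is such an embedding with
constant `6D`, resp. `6mD`). -/
theorem statement11 (X : Type u) [MetricSpace X] [Fintype X] (m : ℕ)
    (hfin : c1dom (dist : X → X → ℝ) m ≠ ⊤) :
    (∀ D : ℝ, 1 ≤ D → c1dom (dist : X → X → ℝ) m < ENNReal.ofReal D →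
      ∃ (T : Fin (3 * m) → Type u) (I : ∀ i, MetricSpace (T i)),
        (∀ i, @IsRTree (T i) (I i)) ∧
        ∃ f : Lamp X → ∀ i, T i,
          BiLipWith (fun p q : Lamp X => TSCP (dist : X → X → ℝ) p q + rho p q)
            (piL1Dist I) (6 * D) f) ∧
    (∀ D : ℝ, 1 ≤ D → cEmb (dist : X → X → ℝ) (l1Dist m) < ENNReal.ofReal D →
      ∃ (T : Fin (3 * m) → Type u) (I : ∀ i, MetricSpace (T i)),
        (∀ i, @IsRTree (T i) (I i)) ∧
        ∃ f : Lamp X → ∀ i, T i,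
          BiLipWith (fun p q : Lamp X => TSCP (dist : X → X → ℝ) p q + rho p q)
            (piL1Dist I) (6 * m * D) f) := by
  have hm : 0 < m := by
    rcases Nat.eq_zero_or_pos m with rfl | hm
    · refine absurd ?_ hfin
      rw [c1dom, sInf_eq_top]
      rintro _ ⟨C, _, _, φ, α, _, _, _, hα, _⟩
      simp at hα
    · exact hm
  refine ⟨fun D hD hlt => ?_, fun D hD hlt => ?_⟩
  · obtain ⟨_, ⟨C, hC, rfl, φ, α, _, hφ, hα, hsum, hlow⟩, hCD⟩ := sInf_lt_iff.1 hlt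
    have hCD' : C < D := (ENNReal.ofReal_lt_ofReal_iff (by linarith)).1 hCD
    have habs : ∀ i a b, |α i * φ i a - α i * φ i b| = α i * |φ i a - φ i b| := fun i a b => by
      rw [← mul_sub, abs_mul, abs_of_nonneg (hα i)]
    refine exists_biLipWith_trees hm (fun i a => α i * φ i a) α hC hα (fun i a b => ?_)
      (fun a b => ?_) (by rw [hsum]; linarith) (by linarith)
    · rw [habs]
      exact mul_le_mul_of_nonneg_left (hφ i a b) (hα i)
    · simp only [habs]
      have h := hlow a b
      rwa [div_le_iff₀' hC] at h
  · obtain ⟨_, ⟨C, hC, rfl, g, _, s, hs, hg⟩, hCD⟩ := sInf_lt_iff.1 hlt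
    have hCD' : C < D := (ENNReal.ofReal_lt_ofReal_iff (by linarith)).1 hCD
    have hm1 : (1 : ℝ) ≤ m := Nat.one_le_cast.2 hm
    have habs : ∀ a b, ∑ i, |g a i / s - g b i / s| = l1Dist m (g a) (g b) / s := fun a b => by
      simp only [l1Dist, Finset.sum_div, ← sub_div, abs_div, abs_of_pos hs]
    refine exists_biLipWith_trees hm (fun i a => g a i / s) (fun _ => C) one_pos
      (fun _ => hC.le) (fun i a b => ?_) (fun a b => ?_) ?_ ?_
    · refine (Finset.single_le_sum (f := fun i => |g a i / s - g b i / s|)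
        (fun _ _ => abs_nonneg _) (Finset.mem_univ i)).trans ?_
      rw [habs, div_le_iff₀ hs]
      linarith [(hg a b).2]
    · rw [habs, one_mul, le_div_iff₀ hs]
      linarith [(hg a b).1]
    · simp only [Finset.sum_const, Finset.card_univ, Fintype.card_fin, nsmul_eq_mul, mul_one]
      nlinarith
    · nlinarith

end Lamplighter
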